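/- arXiv:1611.07777 — 5 statements merged into one kernel-verified Lean document; each statement's English description precedes it below -/
import Mathlib

section
/- Let a > 0 and λ > 0, and define the three threshold values t₁* = ((27λa²/8)^{1/3} − 1)/a, t₂* = (λ/2)a, and t₃* = √λ − 1/(2a). Then t₁* ≤ t₃* ≤ t₂*. Moreover, if λ = 1/a², then t₁* = t₂* = t₃* = 1/(2a). -/
noncomputable section

theorem cube_root_le_add_half {s : ℝ} (hs : 0 < s) :
    (27 / 8 * s ^ 2) ^ ((1 : ℝ) / 3) ≤ s + 1 / 2 := by
  have hcube : 27 / 8 * s ^ 2 ≤ (s + 1 / 2) ^ 3 := by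
    nlinarith [mul_nonneg (sq_nonneg (s - 1)) (by positivity : (0 : ℝ) ≤ s + 1 / 8)]
  have hroot : ((s + 1 / 2) ^ 3) ^ ((1 : ℝ) / 3) = s + 1 / 2 := by
    rw [← Real.rpow_natCast, ← Real.rpow_mul (by positivity)]
    norm_num
  calc (27 / 8 * s ^ 2) ^ ((1 : ℝ) / 3) ≤ ((s + 1 / 2) ^ 3) ^ ((1 : ℝ) / 3) := by gcongr
    _ = s + 1 / 2 := hroot

theorem cube_root_twentySeven_eighths : (27 / 8 : ℝ) ^ ((1 : ℝ) / 3) = 3 / 2 := by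
  rw [show (27 / 8 : ℝ) = (3 / 2) ^ (3 : ℝ) by norm_num, ← Real.rpow_mul (by norm_num)]
  norm_num

/-- Lemma 1: for `a, λ > 0`, the three threshold values
`t₁* = ((27λa²/8)^{1/3} − 1)/a`, `t₂* = (λ/2)a`, `t₃* = √λ − 1/(2a)` satisfy
`t₁* ≤ t₃* ≤ t₂*`, and all equal `1/(2a)` when `λ = 1/a²`. -/
theorem threshold_values_ordered (a lam : ℝ) (ha : 0 < a) (hlam : 0 < lam)
    (t1 t2 t3 : ℝ)
    (ht1 : t1 = ((27 / 8 * lam * a ^ 2) ^ ((1 : ℝ) / 3) - 1) / a)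
    (ht2 : t2 = lam / 2 * a)
    (ht3 : t3 = Real.sqrt lam - 1 / (2 * a)) :
    t1 ≤ t3 ∧ t3 ≤ t2 ∧
      (lam = 1 / a ^ 2 → t1 = 1 / (2 * a) ∧ t2 = 1 / (2 * a) ∧ t3 = 1 / (2 * a)) := by
  subst ht1 ht2 ht3
  obtain ⟨r, hr, rfl⟩ : ∃ r : ℝ, 0 < r ∧ lam = r ^ 2 :=
    ⟨√lam, Real.sqrt_pos.2 hlam, (Real.sq_sqrt hlam.le).symm⟩
  rw [Real.sqrt_sq hr.le]
  refine ⟨?_, ?_, fun h => ?_⟩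
  · have hroot := cube_root_le_add_half (mul_pos hr ha)
    rw [mul_pow, ← mul_assoc] at hroot
    rw [div_le_iff₀ ha]
    have : (r - 1 / (2 * a)) * a = r * a - 1 / 2 := by field_simp
    linarith
  · have : r ^ 2 / 2 * a - (r - 1 / (2 * a)) = (r * a - 1) ^ 2 / (2 * a) := by
      field_simp
      ring
    have : 0 ≤ (r * a - 1) ^ 2 / (2 * a) := by positivity
    linarith
  · obtain rfl : r = 1 / a := by
      rw [← one_div_pow] at h
      exact (pow_left_inj₀ hr.le (by positivity) two_ne_zero).1 h
    have harg : 27 / 8 * (1 / a) ^ 2 * a ^ 2 = 27 / 8 := by field_simp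
    rw [harg, cube_root_twentySeven_eighths]
    refine ⟨?_, ?_, ?_⟩ <;> field_simp <;> norm_num
end
end

section
/- Let a > 0 and λ > 0. For γ₁, γ₂ ∈ ℝ, let β₁ be a global minimizer over β ∈ ℝ of (β − γ₁)² + λ·ρ_a(β) and let β₂ be a global minimizer over β ∈ ℝ of (β − γ₂)² + λ·ρ_a(β). Then (β₁ − β₂)(γ₁ − γ₂) ≥ 0; that is, the thresholding map defined by these minimizers is monotone. -/
noncomputable section

/-- The fraction function `ρ_a(t) = a|t|/(a|t|+1)`. -/
def fracFn (a t : ℝ) : ℝ := a * |t| / (a * |t| + 1)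

/-- Lemma 3: the thresholding map defined by global minimizers of
`β ↦ (β−γ)² + λρ_a(β)` is monotone: `(β₁ − β₂)(γ₁ − γ₂) ≥ 0`. -/
theorem scalar_minimizer_monotone (a lam : ℝ) (ha : 0 < a) (hlam : 0 < lam)
    (γ₁ γ₂ β₁ β₂ : ℝ)
    (hβ₁ : ∀ β : ℝ, (β₁ - γ₁) ^ 2 + lam * fracFn a β₁ ≤ (β - γ₁) ^ 2 + lam * fracFn a β)
    (hβ₂ : ∀ β : ℝ, (β₂ - γ₂) ^ 2 + lam * fracFn a β₂ ≤ (β - γ₂) ^ 2 + lam * fracFn a β) :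
    (β₁ - β₂) * (γ₁ - γ₂) ≥ 0 := by
  nlinarith [hβ₁ β₂, hβ₂ β₁]
end
end

section
/- (von Neumann's trace inequality) For any matrices X, Y ∈ ℝ^{m×n} with m ≤ n, Tr(XᵀY) ≤ Σ_{i=1}^{m} σ_i(X)σ_i(Y), where σ₁(X) ≥ σ₂(X) ≥ … ≥ σ_m(X) ≥ 0 and σ₁(Y) ≥ σ₂(Y) ≥ … ≥ σ_m(Y) ≥ 0 are the singular values of X and Y respectively, arranged in descending order. -/
noncomputable section

open Matrix

/-- The singular values of a real matrix (square roots of the eigenvalues of `X * Xᵀ`),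
arranged in descending order. -/
def sval {m n : ℕ} (X : Matrix (Fin m) (Fin n) ℝ) (i : Fin m) : ℝ :=
  ((List.ofFn fun j : Fin m =>
      Real.sqrt ((Matrix.isHermitian_mul_conjTranspose_self X).eigenvalues j)).mergeSort
      (fun x y => decide (y ≤ x)))[(i : ℕ)]'(by simp)

theorem le_sum_mul_of_partial_sums_nonneg {m : ℕ} (s d : Fin m → ℝ) (hs : Antitone s)
    (hd : ∀ r : ℕ, 0 ≤ ∑ i : Fin m, if (i : ℕ) < r then d i else 0)
    {c : ℝ} (hcs : ∀ i, c ≤ s i) : c * ∑ i, d i ≤ ∑ i, s i * d i := by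
  induction m generalizing c with
  | zero => simp
  | succ m ih =>
    have htotal : 0 ≤ ∑ i, d i :=
      (hd (m + 1)).trans_eq (Finset.sum_congr rfl fun i _ => if_pos i.isLt)
    have hinit := ih (fun i => s i.castSucc) (fun i => d i.castSucc)
      (fun i j hij => hs (Fin.castSucc_le_castSucc_iff.mpr hij))
      (fun r => by
        have h := hd (min r m)
        rw [Fin.sum_univ_castSucc] at h
        simpa using h)
      (c := s (Fin.last m)) (fun i => hs (Fin.le_last _))
    have hlast := mul_le_mul_of_nonneg_right (hcs (Fin.last m)) htotal
    rw [Fin.sum_univ_castSucc] at hlast ⊢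
    rw [Fin.sum_univ_castSucc fun i => s i * d i]
    linarith

theorem sum_mul_nonneg_of_partial_sums_nonneg {m : ℕ} {s d : Fin m → ℝ} (hs : Antitone s)
    (hs0 : ∀ i, 0 ≤ s i) (hd : ∀ r : ℕ, 0 ≤ ∑ i : Fin m, if (i : ℕ) < r then d i else 0) :
    0 ≤ ∑ i, s i * d i := by
  simpa using le_sum_mul_of_partial_sums_nonneg s d hs hd hs0

/-- The rearrangement inequality for doubly substochastic matrices. -/
theorem sum_mul_le_of_doublySubstochastic {m : ℕ} {s t : Fin m → ℝ} (hs : Antitone s)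
    (hs0 : ∀ i, 0 ≤ s i) (ht : Antitone t) (ht0 : ∀ i, 0 ≤ t i) {D : Matrix (Fin m) (Fin m) ℝ}
    (hD : ∀ i j, 0 ≤ D i j) (hrow : ∀ i, ∑ j, D i j ≤ 1) (hcol : ∀ j, ∑ i, D i j ≤ 1) :
    ∑ i, ∑ j, s i * (t j * D i j) ≤ ∑ i, s i * t i := by
  suffices h : 0 ≤ ∑ i, s i * (t i - ∑ j, t j * D i j) by
    simp only [mul_sub, Finset.sum_sub_distrib, Finset.mul_sum] at h
    linarith
  refine sum_mul_nonneg_of_partial_sums_nonneg hs hs0 fun r => ?_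
  suffices h : 0 ≤ ∑ j, t j * ((if (j : ℕ) < r then 1 else 0) -
      ∑ i : Fin m, if (i : ℕ) < r then D i j else 0) by
    refine h.trans_eq ?_
    simp only [mul_sub, Finset.sum_sub_distrib, ← Finset.sum_filter, Finset.mul_sum,
      mul_ite, mul_one, mul_zero]
    rw [Finset.sum_comm]
  refine sum_mul_nonneg_of_partial_sums_nonneg ht ht0 fun q => ?_
  simp only [← Finset.sum_filter, Finset.sum_sub_distrib, sub_nonneg]
  rcases le_total q r with hqr | hqr
  · rw [Finset.filter_filter,
      Finset.filter_congr fun j _ => and_iff_left_of_imp fun hj => hj.trans_le hqr]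
    exact Finset.sum_le_sum fun j _ =>
      (Finset.sum_le_sum_of_subset_of_nonneg (Finset.subset_univ _)
        fun i _ _ => hD i j).trans (hcol j)
  · rw [Finset.sum_comm, Finset.filter_filter,
      Finset.filter_congr fun j _ => and_iff_right_of_imp fun hj => hj.trans_le hqr]
    exact Finset.sum_le_sum fun i _ =>
      (Finset.sum_le_sum_of_subset_of_nonneg (Finset.subset_univ _)
        fun j _ _ => hD i j).trans (hrow i)

theorem exists_perm_antitone {m : ℕ} (f : Fin m → ℝ) :
    ∃ σ : Equiv.Perm (Fin m), Antitone (f ∘ σ) :=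
  ⟨Tuple.sort (fun i => -f i), fun i j hij => by
    simpa using Tuple.monotone_sort (fun i => -f i) hij⟩

theorem antitone_sval {m n : ℕ} (X : Matrix (Fin m) (Fin n) ℝ) : Antitone (sval X) := by
  have h := (List.sortedGE_mergeSort (l := List.ofFn fun j : Fin m =>
    Real.sqrt ((Matrix.isHermitian_mul_conjTranspose_self X).eigenvalues j))).antitone_get
  intro i j hij
  exact h (a := ⟨i, by simp⟩) (b := ⟨j, by simp⟩) hij

theorem exists_perm_sval {m n : ℕ} (X : Matrix (Fin m) (Fin n) ℝ) :
    ∃ σ : Equiv.Perm (Fin m), ∀ i,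
      sval X i = Real.sqrt ((Matrix.isHermitian_mul_conjTranspose_self X).eigenvalues (σ i)) := by
  set f : Fin m → ℝ := fun j =>
    Real.sqrt ((Matrix.isHermitian_mul_conjTranspose_self X).eigenvalues j) with hf
  obtain ⟨σ, hσ⟩ := exists_perm_antitone f
  refine ⟨σ, fun i => ?_⟩
  have hsval : List.ofFn (sval X) = (List.ofFn f).mergeSort (fun x y => decide (y ≤ x)) :=
    List.ext_getElem (by simp) fun k _ _ => by simp [sval, hf]
  have hperm : (List.ofFn (sval X)).Perm (List.ofFn (f ∘ σ)) := by
    rw [hsval]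
    exact (List.mergeSort_perm _ _).trans (σ.ofFn_comp_perm f).symm
  have heq := hperm.eq_of_sortedGE (antitone_sval X).sortedGE_ofFn hσ.sortedGE_ofFn
  exact congrFun (List.ofFn_injective heq) i

theorem sval_nonneg {m n : ℕ} (X : Matrix (Fin m) (Fin n) ℝ) (i : Fin m) : 0 ≤ sval X i := by
  obtain ⟨σ, hσ⟩ := exists_perm_sval X
  rw [hσ]
  exact Real.sqrt_nonneg _

/-- The rows of `P` are pairwise orthogonal and have norm at most one. -/
def HasSuborthonormalRows {m n : ℕ} (P : Matrix (Fin m) (Fin n) ℝ) : Prop :=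
  ∃ ε : Fin m → ℝ, P * Pᵀ = diagonal ε ∧ ∀ i, ε i ≤ 1

namespace HasSuborthonormalRows

variable {m n : ℕ} {P Q : Matrix (Fin m) (Fin n) ℝ}

/-- Bessel's inequality. -/
theorem mulVec_dotProduct_le (hP : HasSuborthonormalRows P) (x : Fin n → ℝ) :
    (P *ᵥ x) ⬝ᵥ (P *ᵥ x) ≤ x ⬝ᵥ x := by
  obtain ⟨ε, hε, hle⟩ := hP
  have hnonneg : 0 ≤ (x - Pᵀ *ᵥ (P *ᵥ x)) ⬝ᵥ (x - Pᵀ *ᵥ (P *ᵥ x)) :=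
    Finset.sum_nonneg fun i _ => mul_self_nonneg _
  have hcross : x ⬝ᵥ (Pᵀ *ᵥ (P *ᵥ x)) = (P *ᵥ x) ⬝ᵥ (P *ᵥ x) := by
    rw [dotProduct_mulVec, vecMul_transpose]
  have hquad : (Pᵀ *ᵥ (P *ᵥ x)) ⬝ᵥ (Pᵀ *ᵥ (P *ᵥ x)) ≤ (P *ᵥ x) ⬝ᵥ (P *ᵥ x) := by
    rw [dotProduct_mulVec, vecMul_transpose, mulVec_mulVec, hε]
    refine Finset.sum_le_sum fun i _ => ?_
    rw [mulVec_diagonal]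
    nlinarith [mul_le_mul_of_nonneg_right (hle i) (mul_self_nonneg ((P *ᵥ x) i))]
  simp only [sub_dotProduct, dotProduct_sub] at hnonneg
  rw [dotProduct_comm (Pᵀ *ᵥ (P *ᵥ x)) x, hcross] at hnonneg
  linarith

theorem row_dotProduct_le (hP : HasSuborthonormalRows P) (i : Fin m) : P i ⬝ᵥ P i ≤ 1 := by
  obtain ⟨ε, hε, hle⟩ := hP
  have h := congrFun (congrFun hε i) i
  rw [diagonal_apply_eq] at h
  exact h.trans_le (hle i)

theorem sum_sq_mul_transpose_row_le (hP : HasSuborthonormalRows P) (hQ : HasSuborthonormalRows Q)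
    (i : Fin m) : ∑ j, (P * Qᵀ) i j ^ 2 ≤ 1 := by
  refine le_trans (le_of_eq ?_) ((hQ.mulVec_dotProduct_le (P i)).trans (hP.row_dotProduct_le i))
  refine Finset.sum_congr rfl fun j _ => ?_
  rw [sq]
  have h : (P * Qᵀ) i j = (Q *ᵥ P i) j := dotProduct_comm (P i) (Q j)
  rw [h]

theorem sum_sq_mul_transpose_col_le (hP : HasSuborthonormalRows P) (hQ : HasSuborthonormalRows Q)
    (j : Fin m) : ∑ i, (P * Qᵀ) i j ^ 2 ≤ 1 := by
  refine le_trans (le_of_eq ?_) (hQ.sum_sq_mul_transpose_row_le hP j)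
  refine Finset.sum_congr rfl fun i _ => ?_
  rw [← transpose_apply (P * Qᵀ), transpose_mul, transpose_transpose]

end HasSuborthonormalRows

/-- A singular value decomposition, up to completing the rows of `P` to an orthonormal family. -/
theorem exists_svd {m n : ℕ} (X : Matrix (Fin m) (Fin n) ℝ) :
    ∃ (V : Matrix (Fin m) (Fin m) ℝ) (P : Matrix (Fin m) (Fin n) ℝ),
      HasSuborthonormalRows V ∧ HasSuborthonormalRows P ∧ X = Vᵀ * diagonal (sval X) * P := by
  obtain ⟨σ, hσ⟩ := exists_perm_sval X
  have hX := Matrix.isHermitian_mul_conjTranspose_self X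
  let U : Matrix (Fin m) (Fin m) ℝ := hX.eigenvectorUnitary.val
  have hUtU : Uᵀ * U = 1 := Unitary.coe_star_mul_self hX.eigenvectorUnitary
  let V : Matrix (Fin m) (Fin m) ℝ := Uᵀ.submatrix σ id
  have hVV : V * Vᵀ = 1 := by
    have h : V * Vᵀ = (Uᵀ * U).submatrix σ σ := rfl
    rw [h, hUtU, submatrix_one_equiv]
  have hVV' : Vᵀ * V = 1 := mul_eq_one_comm.mp hVV
  have hnonneg (i : Fin m) : 0 ≤ hX.eigenvalues i :=
    (posSemidef_self_mul_conjTranspose X).eigenvalues_nonneg i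
  have hdiag : (V * X) * (V * X)ᵀ = diagonal fun i => sval X i ^ 2 := by
    have hspec : Uᵀ * (X * Xᵀ) * U = diagonal hX.eigenvalues := by
      have h := hX.conjStarAlgAut_star_eigenvectorUnitary
      rw [Unitary.conjStarAlgAut_star_apply] at h
      exact h
    calc (V * X) * (V * X)ᵀ = (Uᵀ * (X * Xᵀ) * U).submatrix σ σ := by
          simp only [transpose_mul, Matrix.mul_assoc]
          rfl
      _ = diagonal fun i => sval X i ^ 2 := by
          rw [hspec, submatrix_diagonal_equiv]
          congr 1
          ext i
          rw [hσ, Real.sq_sqrt (hnonneg _)]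
          rfl
  have hrow (i : Fin m) (hi : sval X i = 0) : (V * X) i = 0 := by
    have h := congrFun (congrFun hdiag i) i
    rw [diagonal_apply_eq, hi, zero_pow two_ne_zero] at h
    exact dotProduct_self_eq_zero.mp h
  refine ⟨V, diagonal (fun i => (sval X i)⁻¹) * (V * X), ⟨1, by simpa using hVV, by simp⟩,
    ⟨fun i => (sval X i)⁻¹ * sval X i ^ 2 * (sval X i)⁻¹, ?_, fun i => ?_⟩, ?_⟩
  · rw [transpose_mul, diagonal_transpose, Matrix.mul_assoc, ← Matrix.mul_assoc (V * X), hdiag,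
      diagonal_mul_diagonal, diagonal_mul_diagonal]
    simp only [mul_assoc]
  · rcases eq_or_ne (sval X i) 0 with hi | hi
    · simp [hi]
    · field_simp
      rfl
  · have hscale : diagonal (sval X) * (diagonal (fun i => (sval X i)⁻¹) * (V * X)) = V * X := by
      ext i j
      rw [diagonal_mul, diagonal_mul]
      rcases eq_or_ne (sval X i) 0 with hi | hi
      · simp [hrow i hi]
      · field_simp
    rw [Matrix.mul_assoc, hscale, ← Matrix.mul_assoc, hVV', Matrix.one_mul]

/-- Lemma 4 (von Neumann's trace inequality): for `X, Y ∈ ℝ^{m×n}` with `m ≤ n`,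
`Tr(XᵀY) ≤ Σ_{i=1}^m σ_i(X)σ_i(Y)`. -/
theorem vonNeumann_trace_inequality {m n : ℕ} (hmn : m ≤ n)
    (X Y : Matrix (Fin m) (Fin n) ℝ) :
    Matrix.trace (Xᵀ * Y) ≤ ∑ i, sval X i * sval Y i := by
  obtain ⟨V, P, hV, hP, hX⟩ := exists_svd X
  obtain ⟨W, Q, hW, hQ, hY⟩ := exists_svd Y
  have htrace : trace (Xᵀ * Y) =
      ∑ i, ∑ j, sval X i * (sval Y j * ((V * Wᵀ) i j * (P * Qᵀ) i j)) := by
    have hcyc : trace (Xᵀ * Y) = trace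
        (diagonal (sval X) * (V * Wᵀ) * (diagonal (sval Y) * (P * Qᵀ)ᵀ)) := by
      conv_lhs => rw [hX, hY]
      simp only [transpose_mul, transpose_transpose, diagonal_transpose, Matrix.mul_assoc]
      rw [trace_mul_comm]
      simp only [Matrix.mul_assoc]
    rw [hcyc]
    refine Finset.sum_congr rfl fun i _ => ?_
    rw [diag_apply, mul_apply]
    refine Finset.sum_congr rfl fun j _ => ?_
    rw [diagonal_mul, diagonal_mul, transpose_apply]
    ring
  rw [htrace]
  refine le_trans (Finset.sum_le_sum fun i _ => Finset.sum_le_sum fun j _ => ?_)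
    (sum_mul_le_of_doublySubstochastic (antitone_sval X) (sval_nonneg X) (antitone_sval Y)
      (sval_nonneg Y) (D := fun i j => ((V * Wᵀ) i j ^ 2 + (P * Qᵀ) i j ^ 2) / 2)
      (fun i j => by positivity) (fun i => ?_) fun j => ?_)
  · refine mul_le_mul_of_nonneg_left (mul_le_mul_of_nonneg_left ?_ (sval_nonneg Y j))
      (sval_nonneg X i)
    linarith [two_mul_le_add_sq ((V * Wᵀ) i j) ((P * Qᵀ) i j)]
  · rw [← Finset.sum_div, Finset.sum_add_distrib]
    linarith [hV.sum_sq_mul_transpose_row_le hW i, hP.sum_sq_mul_transpose_row_le hQ i]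
  · rw [← Finset.sum_div, Finset.sum_add_distrib]
    linarith [hV.sum_sq_mul_transpose_col_le hW j, hP.sum_sq_mul_transpose_col_le hQ j]
end
end

section
/- Let 𝒜(X) = A·vec(X) for A ∈ ℝ^{d×mn}, b ∈ ℝ^{d}, a > 0, λ > 0. Let X* be a global minimizer of f(X) = ‖𝒜(X) − b‖₂² + λ·P(X) over ℝ^{m×n} with rank(X*) = r, and let X* = U*Σ*(V*)ᵀ be a singular value decomposition of X*, so that 𝒜(X*) = A(V* ⊗ U*)·vec(Σ*). Then the columns of the matrix B* = A(V* ⊗ U*) corresponding to the support (nonzero entries) of the vector y* = vec(Σ*) are linearly independent. -/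
noncomputable section

open Matrix Kronecker

/-- `P(X) = Σ_{i=1}^m ρ_a(σ_i(X))`. -/
def Pmat (a : ℝ) {m n : ℕ} (X : Matrix (Fin m) (Fin n) ℝ) : ℝ := ∑ i, fracFn a (sval X i)

/-- The squared Euclidean norm of a vector. -/
def eucSq {d : ℕ} (v : Fin d → ℝ) : ℝ := ∑ i, (v i) ^ 2

/-- Column-stacking vectorization of a matrix, satisfying `vec (U * Σ * Vᵀ) = (V ⊗ U) (vec Σ)`. -/
def vecM {m n : ℕ} (X : Matrix (Fin m) (Fin n) ℝ) : Fin n × Fin m → ℝ := fun p => X p.2 p.1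

/-- The rectangular diagonal `m × n` matrix `Diag(s₁, …, s_m)`. -/
def rdiag {m n : ℕ} (s : Fin m → ℝ) : Matrix (Fin m) (Fin n) ℝ :=
  Matrix.of fun i j => if (i : ℕ) = (j : ℕ) then s i else 0

theorem Pmat_eq_sum_eigenvalues (a : ℝ) {m n : ℕ} (X : Matrix (Fin m) (Fin n) ℝ) :
    Pmat a X = ∑ j, fracFn a
      (Real.sqrt ((Matrix.isHermitian_mul_conjTranspose_self X).eigenvalues j)) := by
  set f : Fin m → ℝ := fun j =>
    Real.sqrt ((Matrix.isHermitian_mul_conjTranspose_self X).eigenvalues j)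
  set L := (List.ofFn f).mergeSort (fun x y => decide (y ≤ x)) with hL
  have hperm : L.Perm (List.ofFn f) := List.mergeSort_perm _ _
  have hlen : L.length = m := by simp [hL]
  have h1 : Pmat a X = (L.map (fracFn a)).sum := by
    have h2 : L.map (fracFn a) = List.ofFn fun i : Fin m => fracFn a (sval X i) := by
      apply List.ext_getElem
      · simp [hlen]
      · intro i h h'
        simp only [List.getElem_map, List.getElem_ofFn]
        rfl
    rw [h2, List.sum_ofFn]
    rfl
  rw [h1, (hperm.map (fracFn a)).sum_eq, List.map_ofFn, List.sum_ofFn]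
  rfl

theorem rdiag_mul_transpose {m n : ℕ} (hmn : m ≤ n) (s : Fin m → ℝ) :
    (rdiag s : Matrix (Fin m) (Fin n) ℝ) * (rdiag s : Matrix (Fin m) (Fin n) ℝ)ᵀ =
      Matrix.diagonal fun i => s i ^ 2 := by
  ext i j
  rw [Matrix.mul_apply, Finset.sum_eq_single (Fin.castLE hmn i)]
  · by_cases h : i = j
    · subst h
      simp [rdiag, sq]
    · have h' : (j : ℕ) ≠ i := fun e => h (Fin.ext e.symm)
      simp [rdiag, Matrix.diagonal_apply_ne _ h, h']
  · intro k _ hk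
    have : (i : ℕ) ≠ k := fun e => hk (Fin.ext (by simp [e]))
    simp [rdiag, this]
  · simp

theorem fracFn_abs (a t : ℝ) : fracFn a |t| = fracFn a t := by
  simp [fracFn]

/-- `P` of `U * Diag(s) * Vᵀ` with orthogonal `U`, `V`; the entries of `s` may have any sign and order. -/
theorem Pmat_mul_rdiag_mul_transpose (a : ℝ) {m n : ℕ} (hmn : m ≤ n)
    (U : Matrix (Fin m) (Fin m) ℝ) (V : Matrix (Fin n) (Fin n) ℝ)
    (hU : Uᵀ * U = 1) (hV : Vᵀ * V = 1) (s : Fin m → ℝ) :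
    Pmat a (U * (rdiag s : Matrix (Fin m) (Fin n) ℝ) * Vᵀ) = ∑ i, fracFn a (s i) := by
  set X := U * (rdiag s : Matrix (Fin m) (Fin n) ℝ) * Vᵀ with hX
  have hXX : X * Xᴴ = U * (Matrix.diagonal fun i => s i ^ 2) * Uᵀ := by
    rw [← rdiag_mul_transpose hmn, Matrix.conjTranspose_eq_transpose_of_trivial, hX]
    simp only [Matrix.transpose_mul, Matrix.transpose_transpose, Matrix.mul_assoc]
    rw [← Matrix.mul_assoc Vᵀ V, hV, Matrix.one_mul]
  have hchar : (X * Xᴴ).charpoly = (Matrix.diagonal fun i => s i ^ 2).charpoly := by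
    rw [hXX, Matrix.charpoly_mul_comm, ← Matrix.mul_assoc, hU, Matrix.one_mul]
  have hroots := (Matrix.isHermitian_mul_conjTranspose_self X).roots_charpoly_eq_eigenvalues
  have hdiag : (Matrix.diagonal fun i => s i ^ 2).charpoly.roots =
      Finset.univ.val.map fun i => s i ^ 2 := by
    rw [Matrix.charpoly_diagonal, Polynomial.roots_prod]
    · simp only [Polynomial.roots_X_sub_C, Multiset.bind_singleton]
    · exact Finset.prod_ne_zero_iff.mpr fun i _ => Polynomial.X_sub_C_ne_zero _
  rw [hchar, hdiag] at hroots
  rw [Pmat_eq_sum_eigenvalues]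
  have h := congrArg (fun M : Multiset ℝ => (M.map fun e => fracFn a (Real.sqrt e)).sum) hroots
  simp only [Multiset.map_map, Function.comp_def, RCLike.ofReal_real_eq_id, id,
    Real.sqrt_sq_eq_abs, fracFn_abs] at h
  exact h.symm

/-- Strict midpoint concavity of the fraction function away from the origin. -/
theorem fracFn_add_add_fracFn_sub_le {a : ℝ} (ha : 0 < a) {s e : ℝ} (h : |e| ≤ |s|) :
    fracFn a (s + e) + fracFn a (s - e) ≤ 2 * fracFn a s ∧
      (e ≠ 0 → fracFn a (s + e) + fracFn a (s - e) < 2 * fracFn a s) := by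
  have hsum : |s + e| + |s - e| = 2 * |s| := by
    rcases abs_cases s with h1 | h1 <;> rcases abs_cases e with h2 | h2 <;>
    rcases abs_cases (s + e) with h3 | h3 <;> rcases abs_cases (s - e) with h4 | h4 <;> linarith
  have hdiff : (|s + e| - |s - e|) ^ 2 = 4 * e ^ 2 := by
    have : (|s + e| - |s - e|) ^ 2 = 2 * (|s + e| ^ 2 + |s - e| ^ 2) - (|s + e| + |s - e|) ^ 2 := by
      ring
    rw [this, hsum, mul_pow, sq_abs, sq_abs, sq_abs]
    ring
  have key : 2 * fracFn a s - (fracFn a (s + e) + fracFn a (s - e)) =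
      2 * a ^ 2 * e ^ 2 / ((a * |s| + 1) * (a * |s + e| + 1) * (a * |s - e| + 1)) := by
    have hu := abs_nonneg (s + e)
    have hv := abs_nonneg (s - e)
    have hs : |s| = (|s + e| + |s - e|) / 2 := by linarith
    have he : e ^ 2 = (|s + e| - |s - e|) ^ 2 / 4 := by linarith
    simp only [fracFn]
    rw [hs, he]
    generalize |s + e| = u at *
    generalize |s - e| = v at *
    have : a * ((u + v) / 2) + 1 ≠ 0 := by positivity
    have : a * u + 1 ≠ 0 := by positivity
    have : a * v + 1 ≠ 0 := by positivity
    field_simp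
    ring
  constructor
  · have : 0 ≤ 2 * a ^ 2 * e ^ 2 / ((a * |s| + 1) * (a * |s + e| + 1) * (a * |s - e| + 1)) := by
      positivity
    linarith
  · intro he
    have : 0 < 2 * a ^ 2 * e ^ 2 / ((a * |s| + 1) * (a * |s + e| + 1) * (a * |s - e| + 1)) := by
      positivity
    linarith

theorem exists_pos_forall_abs_mul_le {ι : Type*} [Finite ι] (s h : ι → ℝ)
    (hs : ∀ i, s i = 0 → h i = 0) : ∃ t : ℝ, 0 < t ∧ ∀ i, |t * h i| ≤ |s i| := by
  have key : ∀ᶠ t in nhdsWithin (0 : ℝ) (Set.Ioi 0), ∀ i, |t * h i| ≤ |s i| := by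
    rw [Filter.eventually_all]
    intro i
    by_cases hi : s i = 0
    · simp [hi, hs i hi]
    · have hc : Filter.Tendsto (fun t : ℝ => |t * h i|) (nhds 0) (nhds 0) := by
        have : Continuous fun t : ℝ => |t * h i| := by fun_prop
        simpa using this.tendsto 0
      exact ((hc.eventually_lt_const (abs_pos.mpr hi)).mono fun _ => le_of_lt).filter_mono
        nhdsWithin_le_nhds
  obtain ⟨t, ht, ht0⟩ := (key.and self_mem_nhdsWithin).exists
  exact ⟨t, ht0, ht⟩

theorem mulVec_vecM_mul_mul_transpose {m n d : ℕ} (A : Matrix (Fin d) (Fin n × Fin m) ℝ)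
    (U : Matrix (Fin m) (Fin m) ℝ) (V : Matrix (Fin n) (Fin n) ℝ) (M : Matrix (Fin m) (Fin n) ℝ) :
    A.mulVec (vecM (U * M * Vᵀ)) = (A * (V ⊗ₖ U)).mulVec (vecM M) := by
  rw [← Matrix.mulVec_mulVec]
  congr 1
  exact (Matrix.kronecker_mulVec_vec U M V).symm

theorem rdiag_add_smul {m n : ℕ} (s h : Fin m → ℝ) (t : ℝ) :
    (rdiag (fun i => s i + t * h i) : Matrix (Fin m) (Fin n) ℝ) = rdiag s + t • rdiag h := by
  ext i j
  by_cases hij : (i : ℕ) = j <;> simp [rdiag, hij]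

/-- The kernel of `A (V ⊗ U)` contains no nonzero diagonal direction supported on the
support of the singular values of a minimizer. -/
theorem eq_zero_of_mulVec_vecM_rdiag_eq_zero {m n d : ℕ} (hmn : m ≤ n)
    (A : Matrix (Fin d) (Fin n × Fin m) ℝ) (b : Fin d → ℝ) {a lam : ℝ}
    (ha : 0 < a) (hlam : 0 < lam) (U : Matrix (Fin m) (Fin m) ℝ) (V : Matrix (Fin n) (Fin n) ℝ)
    (hU : Uᵀ * U = 1) (hV : Vᵀ * V = 1) (s : Fin m → ℝ)
    (hmin : ∀ X : Matrix (Fin m) (Fin n) ℝ,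
      eucSq (A.mulVec (vecM (U * (rdiag s : Matrix (Fin m) (Fin n) ℝ) * Vᵀ)) - b) +
          lam * Pmat a (U * (rdiag s : Matrix (Fin m) (Fin n) ℝ) * Vᵀ) ≤
        eucSq (A.mulVec (vecM X) - b) + lam * Pmat a X)
    (h : Fin m → ℝ) (hs : ∀ i, s i = 0 → h i = 0)
    (hker : (A * (V ⊗ₖ U)).mulVec (vecM (rdiag h)) = 0) : h = 0 := by
  by_contra hne
  obtain ⟨i₀, hi₀⟩ := Function.ne_iff.mp hne
  obtain ⟨t, ht, hth⟩ := exists_pos_forall_abs_mul_le s h hs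
  have hle : ∀ c : ℝ, ∑ i, fracFn a (s i) ≤ ∑ i, fracFn a (s i + c * h i) := by
    intro c
    have hc := hmin (U * (rdiag fun i => s i + c * h i : Matrix (Fin m) (Fin n) ℝ) * Vᵀ)
    have hvec : (vecM (rdiag (fun i => s i + c * h i)) : Fin n × Fin m → ℝ) =
        vecM (rdiag s) + c • vecM (rdiag h) := by
      rw [rdiag_add_smul]
      rfl
    rw [Pmat_mul_rdiag_mul_transpose a hmn U V hU hV, Pmat_mul_rdiag_mul_transpose a hmn U V hU hV,
      mulVec_vecM_mul_mul_transpose, mulVec_vecM_mul_mul_transpose, hvec, Matrix.mulVec_add,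
      Matrix.mulVec_smul, hker, smul_zero, add_zero] at hc
    exact le_of_mul_le_mul_left (by linarith) hlam
  have hlt : ∑ i, (fracFn a (s i + t * h i) + fracFn a (s i - t * h i)) <
      ∑ i, 2 * fracFn a (s i) :=
    Finset.sum_lt_sum (fun i _ => (fracFn_add_add_fracFn_sub_le ha (hth i)).1)
      ⟨i₀, Finset.mem_univ _, (fracFn_add_add_fracFn_sub_le ha (hth i₀)).2
        (mul_ne_zero ht.ne' hi₀)⟩
  have h₁ := hle t
  have h₂ := hle (-t)
  simp only [neg_mul, ← sub_eq_add_neg] at h₂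
  rw [Finset.sum_add_distrib, ← Finset.mul_sum] at hlt
  linarith

/-- Lemma 5: if `X*` is a global minimizer of `f(X) = ‖A·vec(X) − b‖² + λP(X)` with
`rank(X*) = r` and SVD `X* = U*Σ*(V*)ᵀ`, then the columns of `B* = A(V* ⊗ U*)`
corresponding to the support of `y* = vec(Σ*)` are linearly independent. -/
theorem support_columns_linearIndependent {m n d : ℕ} (hmn : m ≤ n) (r : ℕ)
    (A : Matrix (Fin d) (Fin n × Fin m) ℝ) (b : Fin d → ℝ)
    (a lam : ℝ) (ha : 0 < a) (hlam : 0 < lam)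
    (Xstar : Matrix (Fin m) (Fin n) ℝ)
    (hmin : ∀ X : Matrix (Fin m) (Fin n) ℝ,
      eucSq (A.mulVec (vecM Xstar) - b) + lam * Pmat a Xstar ≤
        eucSq (A.mulVec (vecM X) - b) + lam * Pmat a X)
    (hrank : Xstar.rank = r)
    (Ustar : Matrix (Fin m) (Fin m) ℝ) (Vstar : Matrix (Fin n) (Fin n) ℝ)
    (hU : Ustar * Ustarᵀ = 1 ∧ Ustarᵀ * Ustar = 1)
    (hV : Vstar * Vstarᵀ = 1 ∧ Vstarᵀ * Vstar = 1)
    (Sigstar : Matrix (Fin m) (Fin n) ℝ) (hSig : Sigstar = rdiag (sval Xstar))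
    (hSVD : Xstar = Ustar * Sigstar * Vstarᵀ)
    (Bstar : Matrix (Fin d) (Fin n × Fin m) ℝ) (hB : Bstar = A * (Vstar ⊗ₖ Ustar))
    (ystar : Fin n × Fin m → ℝ) (hy : ystar = vecM Sigstar) :
    LinearIndependent ℝ
      (fun k : {k : Fin n × Fin m // ystar k ≠ 0} => fun i : Fin d => Bstar i k.1) := by
  subst hSig hB hy
  rw [hSVD] at hmin
  set s := sval Xstar
  have hsupp : ∀ k : Fin n × Fin m, vecM (rdiag s) k ≠ 0 →
      k = (Fin.castLE hmn k.2, k.2) := by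
    rintro ⟨j, i⟩ hk
    by_cases hij : (i : ℕ) = j
    · exact Prod.ext (Fin.ext hij.symm) rfl
    · simp [vecM, rdiag, hij] at hk
  classical
  rw [Fintype.linearIndependent_iff]
  intro g hg
  set w : Fin n × Fin m → ℝ := fun k =>
    if hk : vecM (rdiag s) k ≠ 0 then g ⟨k, hk⟩ else 0 with hw
  set h : Fin m → ℝ := fun i => w (Fin.castLE hmn i, i) with hh
  have hwh : vecM (rdiag h) = w := by
    ext ⟨j, i⟩
    by_cases hij : (i : ℕ) = j
    · obtain rfl : j = Fin.castLE hmn i := Fin.ext hij.symm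
      simp [vecM, rdiag, hh]
    · simp [vecM, rdiag, hij, hw]
  have hker : (A * (Vstar ⊗ₖ Ustar)).mulVec (vecM (rdiag h)) = 0 := by
    rw [hwh, ← hg]
    ext i
    rw [Finset.sum_apply, Matrix.mulVec, dotProduct,
      ← Finset.sum_filter_of_ne (p := fun k => vecM (rdiag s) k ≠ 0)
        fun k _ hk hk' => hk (by rw [hw]; simp [hk']),
      Finset.sum_subtype _ (p := fun k => vecM (rdiag s) k ≠ 0) (by simp)]
    refine Finset.sum_congr rfl fun k _ => ?_
    rw [Pi.smul_apply, smul_eq_mul, mul_comm, hw]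
    exact congrArg (· * _) (dif_pos k.2)
  have hzero := eq_zero_of_mulVec_vecM_rdiag_eq_zero hmn A b ha hlam Ustar Vstar hU.2 hV.2 s hmin h
    (fun i hi => by simp [hh, hw, vecM, rdiag, hi]) hker
  rintro ⟨k, hk⟩
  have hgk : w k = g ⟨k, hk⟩ := dif_pos hk
  rw [← hgk, hsupp k hk]
  exact congrFun hzero k.2
end
end

section
/- Let 𝒜(X) = A·vec(X) for A ∈ ℝ^{d×mn}, b ∈ ℝ^{d}, a > 0, λ > 0, and let X* be a global minimizer of f(X) = ‖𝒜(X) − b‖₂² + λ·P(X) over ℝ^{m×n}. If λ > ‖b‖₂², then the largest singular value of X* satisfies ‖σ(X*)‖_∞ = σ₁(X*) ≤ ‖b‖₂² / (a(λ − ‖b‖₂²)). -/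
noncomputable section

open Matrix

theorem fracFn_nonneg {a : ℝ} (ha : 0 < a) (t : ℝ) : 0 ≤ fracFn a t := by
  unfold fracFn
  positivity

theorem sval_zero {m n : ℕ} (i : Fin m) : sval (0 : Matrix (Fin m) (Fin n) ℝ) i = 0 := by
  have hev := (Matrix.isHermitian_mul_conjTranspose_self
    (0 : Matrix (Fin m) (Fin n) ℝ)).eigenvalues_eq_zero_iff.2 (by simp)
  have hmem : sval (0 : Matrix (Fin m) (Fin n) ℝ) i ∈ List.ofFn fun j : Fin m =>
      Real.sqrt ((Matrix.isHermitian_mul_conjTranspose_self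
        (0 : Matrix (Fin m) (Fin n) ℝ)).eigenvalues j) :=
    List.mem_mergeSort.1 (List.getElem_mem _)
  obtain ⟨j, hj⟩ := List.mem_ofFn.1 hmem
  rw [← hj, hev, Pi.zero_apply, Real.sqrt_zero]

theorem Pmat_zero (a : ℝ) {m n : ℕ} : Pmat a (0 : Matrix (Fin m) (Fin n) ℝ) = 0 := by
  simp [Pmat, sval_zero, fracFn]

theorem fracFn_sval_le_Pmat {a : ℝ} (ha : 0 < a) {m n : ℕ} (X : Matrix (Fin m) (Fin n) ℝ)
    (i : Fin m) : fracFn a (sval X i) ≤ Pmat a X :=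
  Finset.single_le_sum (f := fun i => fracFn a (sval X i))
    (fun _ _ => fracFn_nonneg ha _) (Finset.mem_univ i)

theorem eucSq_nonneg {d : ℕ} (v : Fin d → ℝ) : 0 ≤ eucSq v :=
  Finset.sum_nonneg fun _ _ => sq_nonneg _

theorem le_div_of_mul_fracFn_le {a lam B t : ℝ} (ha : 0 < a) (hlam : B < lam)
    (h : lam * fracFn a t ≤ B) : t ≤ B / (a * (lam - B)) := by
  have hden : 0 < a * |t| + 1 := by positivity
  rw [fracFn, ← mul_div_assoc, div_le_iff₀ hden] at h
  refine (le_abs_self t).trans ((le_div_iff₀ (mul_pos ha (sub_pos.2 hlam))).2 ?_)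
  linarith

/-- Theorem 6 (1): if `X*` is a global minimizer of `f(X) = ‖A·vec(X) − b‖² + λP(X)` and
`λ > ‖b‖₂²`, then `‖σ(X*)‖_∞ ≤ ‖b‖₂² / (a(λ − ‖b‖₂²))`, i.e. every singular value of `X*`
is bounded by `‖b‖₂² / (a(λ − ‖b‖₂²))`. -/
theorem sval_bound_of_minimizer {m n d : ℕ} (hmn : m ≤ n)
    (A : Matrix (Fin d) (Fin n × Fin m) ℝ) (b : Fin d → ℝ)
    (a lam : ℝ) (ha : 0 < a)
    (Xstar : Matrix (Fin m) (Fin n) ℝ)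
    (hmin : ∀ X : Matrix (Fin m) (Fin n) ℝ,
      eucSq (A.mulVec (vecM Xstar) - b) + lam * Pmat a Xstar ≤
        eucSq (A.mulVec (vecM X) - b) + lam * Pmat a X)
    (hlam : lam > eucSq b) :
    ∀ i : Fin m, sval Xstar i ≤ eucSq b / (a * (lam - eucSq b)) := by
  intro i
  have hzero : eucSq (A.mulVec (vecM (0 : Matrix (Fin m) (Fin n) ℝ)) - b) = eucSq b := by
    have hvec : vecM (0 : Matrix (Fin m) (Fin n) ℝ) = 0 := rfl
    simp [hvec, eucSq]
  have hle := hmin 0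
  rw [Pmat_zero, hzero, mul_zero, add_zero] at hle
  have hlam_nonneg : 0 ≤ lam := (eucSq_nonneg b).trans hlam.le
  refine le_div_of_mul_fracFn_le ha hlam ?_
  linarith [mul_le_mul_of_nonneg_left (fracFn_sval_le_Pmat ha Xstar i) hlam_nonneg,
    eucSq_nonneg (A.mulVec (vecM Xstar) - b)]
end
end
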